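/- Let A ⊂ ℝ^k be a measurable set, n ≤ k, f : A → ℓ^∞ a Lipschitz map, and fix j ∈ {0,1,…,n−1}. Then the set of points x ∈ A at which Θ^{*n}(f,x) > 0, the component-wise approximate derivative ap Df(x) exists, and rank(ap Df(x)) = j, has Lebesgue measure zero. -/

import Mathlib

open MeasureTheory Metric Set Filter
open scoped ENNReal NNReal Topology

noncomputable section

abbrev EucSp (k : ℕ) := EuclideanSpace ℝ (Fin k)

/-- The volume of the unit ball in `ℝ^n`. -/
def unitBallVol (n : ℕ) : ℝ≥0∞ := volume (Metric.ball (0 : EucSp n) 1)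

/-- The `n`-dimensional Hausdorff content. -/
def hContent {X : Type*} [PseudoEMetricSpace X] (n : ℕ) (E : Set X) : ℝ≥0∞ :=
  ⨅ (A : ℕ → Set X) (_ : E ⊆ ⋃ i, A i),
    unitBallVol n / 2 ^ n * ∑' i, EMetric.diam (A i) ^ n

/-- Upper n-density. -/
def upperDensity {k : ℕ} {X : Type*} [PseudoEMetricSpace X] (n : ℕ)
    (f : EucSp k → X) (A : Set (EucSp k)) (x : EucSp k) : ℝ≥0∞ :=
  Filter.limsup
    (fun r : ℝ => hContent n (f '' (Metric.ball x r ∩ A)) /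
      (unitBallVol n * ENNReal.ofReal r ^ n)) (𝓝[>] (0:ℝ))

def lowerDensity {k : ℕ} {X : Type*} [PseudoEMetricSpace X] (n : ℕ)
    (f : EucSp k → X) (A : Set (EucSp k)) (x : EucSp k) : ℝ≥0∞ :=
  Filter.liminf
    (fun r : ℝ => hContent n (f '' (Metric.ball x r ∩ A)) /
      (unitBallVol n * ENNReal.ofReal r ^ n)) (𝓝[>] (0:ℝ))

def IsDensityPoint {k : ℕ} (E : Set (EucSp k)) (x : EucSp k) : Prop :=
  Filter.Tendsto (fun r : ℝ => volume (E ∩ Metric.ball x r) / volume (Metric.ball x r))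
    (𝓝[>] (0:ℝ)) (𝓝 1)

def HasApproxDerivWithinAt {k : ℕ} (A : Set (EucSp k)) (f : EucSp k → ℝ)
    (L : EucSp k →ₗ[ℝ] ℝ) (x : EucSp k) : Prop :=
  ∃ Ax : Set (EucSp k), Ax ⊆ A ∧ MeasurableSet Ax ∧ IsDensityPoint Ax x ∧
    Filter.Tendsto (fun y => |f y - f x - L (y - x)| / ‖y - x‖) (𝓝[Ax] x) (𝓝 0)

abbrev LpInfty := lp (fun _ : ℕ => ℝ) ∞

def HasCompApproxDerivWithinAt {k : ℕ} (A : Set (EucSp k)) (f : EucSp k → LpInfty)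
    (D : EucSp k →ₗ[ℝ] (ℕ → ℝ)) (x : EucSp k) : Prop :=
  ∀ i : ℕ, HasApproxDerivWithinAt A (fun y => f y i) ((LinearMap.proj i).comp D) x

def IsBiLipC1DiffeoOn {k : ℕ} (G Ginv : EucSp k → EucSp k) (U : Set (EucSp k)) : Prop :=
  IsOpen U ∧ IsOpen (G '' U) ∧ (∀ x ∈ U, Ginv (G x) = x) ∧ (∀ y ∈ G '' U, G (Ginv y) = y) ∧
    ContDiffOn ℝ 1 G U ∧ ContDiffOn ℝ 1 Ginv (G '' U) ∧
    ∃ Λ : ℝ≥0, LipschitzOnWith Λ G U ∧ LipschitzOnWith Λ Ginv (G '' U)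

def IsFinCoordPerm (Ψ : LpInfty → LpInfty) : Prop :=
  ∃ σ : Equiv.Perm ℕ, {i | σ i ≠ i}.Finite ∧ ∀ (x : LpInfty) (i : ℕ), Ψ x i = x (σ i)

def openCube {k : ℕ} (c : EucSp k) (d : ℝ) : Set (EucSp k) := {x | ∀ i, |x i - c i| < d / 2}

def closedCube {k : ℕ} (c : EucSp k) (d : ℝ) : Set (EucSp k) := {x | ∀ i, |x i - c i| ≤ d / 2}

def hnmContent {N : ℕ} {X : Type*} [PseudoEMetricSpace X] (n m : ℕ)
    (f : EucSp N → X) (Q : Set (EucSp N)) : ℝ≥0∞ :=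
  ⨅ (c : ℕ → EucSp N) (d : ℕ → ℝ) (_ : ∀ j, 0 ≤ d j) (_ : ∀ j, openCube (c j) (d j) ⊆ Q)
    (_ : Pairwise (Function.onFun Disjoint fun j => openCube (c j) (d j)))
    (_ : volume (Q \ ⋃ j, openCube (c j) (d j)) = 0),
    ∑' j, hContent n (f '' openCube (c j) (d j)) * ENNReal.ofReal (d j) ^ m

def matrixRow {n k : ℕ} (D : Matrix (Fin n) (Fin k) ℝ) (i : Fin n) : EucSp k →ₗ[ℝ] ℝ :=
  (EuclideanSpace.proj i).toLinearMap.comp (Matrix.toEuclideanLin D)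

def jacDet {n k : ℕ} (D : Matrix (Fin n) (Fin k) ℝ) : ℝ := Real.sqrt ((D * D.transpose).det)

def upperLintegral {Y : Type*} [MeasurableSpace Y] (μ : Measure Y) (g : Y → ℝ≥0∞) : ℝ≥0∞ :=
  ⨅ (h : Y → ℝ≥0∞) (_ : Measurable h) (_ : ∀ y, g y ≤ h y), ∫⁻ y, h y ∂μ


lemma scalar_avg {k : ℕ} {g : EucSp k → ℝ} {L : ℝ≥0} (hg : LipschitzWith L g)
    (z u : EucSp k) {ρ : ℝ} (S : Set (EucSp k)) (hS : MeasurableSet S)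
    {η c : ℝ} (hη : 0 ≤ η) (hSη : ∀ p ∈ S, |lineDeriv ℝ g p u| ≤ η)
    (hc : ∀ t ∈ Icc (0:ℝ) 1, volume.real (ball (z + t • u) ρ \ S) ≤ c) :
    |g (z + u) - g z| * volume.real (ball (0 : EucSp k) ρ) ≤
      (2 * L * ρ + η) * volume.real (ball (0 : EucSp k) ρ) + L * ‖u‖ * c := by
  set B := ball (0 : EucSp k) ρ with hB
  have hBfin : volume B ≠ ⊤ := measure_ball_lt_top.ne
  have : IsFiniteMeasure (volume.restrict B) := ⟨by simpa using measure_ball_lt_top⟩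
  set h : ℝ → ℝ := fun t => ∫ w in B, g (z + w + t • u) with hh
  have hint : ∀ t : ℝ, IntegrableOn (fun w => g (z + w + t • u)) B := by
    intro t
    have : Continuous (fun w => g (z + w + t • u)) := by
      have := hg.continuous
      fun_prop
    exact (this.locallyIntegrable.integrableOn_isCompact
      (isCompact_closedBall (0 : EucSp k) ρ)).mono_set ball_subset_closedBall
  set h' : ℝ → ℝ := fun t => ∫ w in B, lineDeriv ℝ g (z + w + t • u) u with hh'
  have hlm : Measurable (fun p => lineDeriv ℝ g p u) := measurable_lineDeriv hg.continuous
  have hder : ∀ t, HasDerivAt h (h' t) t := by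
    intro t
    refine (hasDerivAt_integral_of_dominated_loc_of_lip (μ := volume.restrict B)
      (bound := fun _ => L * ‖u‖) (F := fun t w => g (z + w + t • u))
      (F' := fun w => lineDeriv ℝ g (z + w + t • u) u) (s := univ) univ_mem
      ?_ (hint t) ?_ ?_ ?_ ?_).2
    · exact Eventually.of_forall fun s => (hint s).aestronglyMeasurable
    · exact (hlm.comp (by fun_prop)).aestronglyMeasurable
    · refine Eventually.of_forall fun w => ?_
      refine LipschitzOnWith.of_dist_le_mul fun a _ b _ => ?_
      refine (hg.dist_le_mul _ _).trans ?_
      simp only [Real.coe_nnabs]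
      rw [abs_of_nonneg (by positivity), dist_add_left, dist_eq_norm, ← sub_smul, norm_smul,
        dist_eq_norm]
      exact le_of_eq (by ring)
    · exact integrable_const _
    · have h1 : ∀ᵐ p ∂(volume : Measure (EucSp k)), LineDifferentiableAt ℝ g p u :=
        hg.ae_lineDifferentiableAt u
      have h2 : ∀ᵐ w ∂(volume : Measure (EucSp k)),
          LineDifferentiableAt ℝ g ((z + t • u) + w) u :=
        (measurePreserving_add_left volume (z + t • u)).quasiMeasurePreserving.ae h1
      refine ae_restrict_of_ae (h2.mono fun w hw => ?_)
      have h3 : HasLineDerivAt ℝ g (lineDeriv ℝ g (z + w + t • u) u) (z + w + t • u) u := by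
        have : z + w + t • u = (z + t • u) + w := by abel
        rw [this]; exact hw.hasLineDerivAt
      unfold HasLineDerivAt at h3
      have h4 : HasDerivAt (fun s : ℝ => s - t) 1 t := (hasDerivAt_id t).sub_const t
      have h5 := HasDerivAt.scomp_of_eq t h3 h4 (by simp)
      simp only [one_smul] at h5
      refine h5.congr_of_eventuallyEq (Eventually.of_forall fun s => ?_)
      simp only [Function.comp]
      congr 1
      rw [sub_smul]; abel
  have hbd : ∀ t ∈ Icc (0:ℝ) 1, ‖h' t‖ ≤ η * volume.real B + L * ‖u‖ * c := by
    intro t ht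
    set T : Set (EucSp k) := (fun w => (z + t • u) + w) ⁻¹' Sᶜ with hT
    have hTm : MeasurableSet T := (by fun_prop : Measurable fun w => (z + t • u) + w) hS.compl
    have hTv : volume.real (T ∩ B) ≤ c := by
      refine le_trans (le_of_eq ?_) (hc t ht)
      have : T ∩ B = (fun w => (z + t • u) + w) ⁻¹' (ball (z + t • u) ρ \ S) := by
        ext w
        simp [hT, hB, and_comm]
      rw [this, measureReal_def, measure_preimage_add, measureReal_def]
    calc ‖h' t‖ ≤ ∫ w in B, (η + T.indicator (fun _ => L * ‖u‖) w) := by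
          refine norm_integral_le_of_norm_le ?_ (Eventually.of_forall fun w => ?_)
          · exact (integrable_const _).add ((integrable_const _).indicator hTm)
          · by_cases hw : w ∈ T
            · rw [indicator_of_mem hw]
              have := norm_lineDeriv_le_of_lipschitz ℝ hg (x₀ := z + w + t • u) (v := u)
              linarith
            · rw [indicator_of_notMem hw, add_zero]
              apply hSη
              simp only [hT, mem_preimage, mem_compl_iff, not_not] at hw
              convert hw using 1
              abel
      _ = η * volume.real B + L * ‖u‖ * volume.real (T ∩ B) := by
          rw [integral_add (integrable_const _) ((integrable_const _).indicator hTm),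
            integral_indicator hTm, setIntegral_const, Measure.restrict_restrict hTm,
            setIntegral_const]
          simp only [smul_eq_mul]
          ring
      _ ≤ _ := by gcongr
  have hmv : ‖h 1 - h 0‖ ≤ η * volume.real B + L * ‖u‖ * c :=
    norm_image_sub_le_of_norm_deriv_le_segment_01' (fun t _ => (hder t).hasDerivWithinAt)
      (fun t ht => hbd t ⟨ht.1, ht.2.le⟩)
  have hav : ∀ t : ℝ, ‖h t - volume.real B * g (z + t • u)‖ ≤ L * ρ * volume.real B := by
    intro t
    have e : h t - volume.real B * g (z + t • u)
        = ∫ w in B, (g (z + w + t • u) - g (z + t • u)) := by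
      rw [integral_sub (hint t) (integrable_const _), setIntegral_const, smul_eq_mul]
    rw [e]
    refine norm_setIntegral_le_of_norm_le_const (measure_ball_lt_top) fun w hw => ?_
    rw [← dist_eq_norm]
    refine (hg.dist_le_mul _ _).trans ?_
    gcongr
    rw [dist_eq_norm]
    have : z + w + t • u - (z + t • u) = w := by abel
    rw [this]
    simpa [hB] using (mem_ball_zero_iff.1 hw).le
  have a1 := hav 1
  have a0 := hav 0
  simp only [one_smul, zero_smul, add_zero, Real.norm_eq_abs] at a1 a0 hmv
  have hv : 0 ≤ volume.real B := measureReal_nonneg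
  rw [← abs_of_nonneg hv, ← abs_mul]
  rw [abs_le] at *
  simp only [abs_of_nonneg hv] at *
  constructor <;> nlinarith

lemma density_real {k : ℕ} {E : Set (EucSp k)} (hE : MeasurableSet E) {x : EucSp k}
    (hd : Tendsto (fun r => volume (E ∩ closedBall x r) / volume (closedBall x r))
      (𝓝[>] 0) (𝓝 1)) {θ : ℝ} (hθ : 0 < θ) :
    ∀ᶠ r in 𝓝[>] (0:ℝ),
      volume.real (closedBall x r \ E) ≤ θ * volume.real (closedBall x r) := by
  have h1 : Tendsto (fun r => (volume (E ∩ closedBall x r) / volume (closedBall x r)).toReal)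
      (𝓝[>] 0) (𝓝 1) := by
    have := (ENNReal.tendsto_toReal ENNReal.one_ne_top).comp hd
    rwa [ENNReal.toReal_one] at this
  filter_upwards [(tendsto_order.1 h1).1 (1 - θ) (by linarith), self_mem_nhdsWithin] with r hr h0
  have hpos : 0 < volume.real (closedBall x r) :=
    ENNReal.toReal_pos (measure_closedBall_pos _ _ h0).ne' measure_closedBall_lt_top.ne
  rw [ENNReal.toReal_div] at hr
  change 1 - θ < volume.real _ / volume.real _ at hr
  rw [lt_div_iff₀ hpos] at hr
  have := measureReal_inter_add_sdiff (μ := volume) (s := closedBall x r) hE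
    measure_closedBall_lt_top.ne
  rw [inter_comm] at this
  linarith

lemma lemA {k : ℕ} (L : ℝ≥0) (x v : EucSp k) (E : Set (EucSp k)) (hE : MeasurableSet E)
    (hd : Tendsto (fun r => volume (E ∩ closedBall x r) / volume (closedBall x r))
      (𝓝[>] 0) (𝓝 1)) {η ε : ℝ} (hη : 0 ≤ η) (hε : 0 < ε) :
    ∀ᶠ r in 𝓝[>] (0:ℝ), ∀ z ∈ ball x r, ∀ g : EucSp k → ℝ, LipschitzWith L g →
      (∀ p ∈ E, |lineDeriv ℝ g p v| ≤ η) → |g (z + r • v) - g z| ≤ (η + ε) * r := by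
  set δ : ℝ := ε / (4 * (L + 1)) with hδ
  have hδ0 : 0 < δ := by positivity
  have hδ1 : 2 * L * δ ≤ ε / 2 := by
    rw [hδ, mul_div_assoc', div_le_iff₀ (by positivity)]
    nlinarith [L.2]
  set M : ℝ := 1 + ‖v‖ + δ with hM
  have hM0 : 0 < M := by positivity
  set θ : ℝ := ε / 2 / ((L * ‖v‖ + 1) * (M / δ) ^ k) with hθ
  have hθ0 : 0 < θ := by positivity
  have hθ1 : L * ‖v‖ * (θ * (M / δ) ^ k) ≤ ε / 2 := by
    have e : θ * (M / δ) ^ k = ε / 2 / (L * ‖v‖ + 1) := by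
      rw [hθ]; field_simp
    rw [e, mul_div_assoc', div_le_iff₀ (by positivity)]
    nlinarith
  have hM1 : Tendsto (fun r : ℝ => M * r) (𝓝[>] 0) (𝓝[>] 0) := by
    refine tendsto_nhdsWithin_iff.2 ⟨?_, ?_⟩
    · have : Tendsto (fun r : ℝ => M * r) (𝓝 0) (𝓝 (M * 0)) := (continuous_const_mul M).tendsto 0
      rw [mul_zero] at this
      exact this.mono_left nhdsWithin_le_nhds
    · filter_upwards [self_mem_nhdsWithin] with r hr
      exact mul_pos hM0 hr
  filter_upwards [hM1.eventually (density_real hE hd hθ0), self_mem_nhdsWithin] with r hr hr0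
  have hr0 : 0 < r := hr0
  intro z hz g hg hgE
  have key := scalar_avg hg z (r • v) (ρ := δ * r) E hE (η := η * r)
    (c := θ * volume.real (closedBall x (M * r))) (by positivity) ?_ ?_
  · set V := volume.real (ball (0 : EucSp k) 1)
    have e1 : volume.real (ball (0 : EucSp k) (δ * r)) = (δ * r) ^ k * V := by
      rw [measureReal_def, Measure.addHaar_ball_of_pos _ _ (by positivity), ENNReal.toReal_mul,
        ENNReal.toReal_ofReal (by positivity)]
      simp [V, measureReal_def]
    have e2 : volume.real (closedBall x (M * r)) = (M / δ) ^ k * ((δ * r) ^ k * V) := by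
      rw [measureReal_def, Measure.addHaar_closedBall _ _ (by positivity), ENNReal.toReal_mul,
        ENNReal.toReal_ofReal (by positivity), ← mul_assoc, ← mul_pow]
      have : M / δ * (δ * r) = M * r := by field_simp
      rw [this]
      simp [V, measureReal_def]
    have hW : 0 < (δ * r) ^ k * V := by
      rw [← e1]
      exact ENNReal.toReal_pos (measure_ball_pos _ _ (by positivity)).ne' measure_ball_lt_top.ne
    rw [e1, e2] at key
    set W := (δ * r) ^ k * V
    rw [norm_smul, Real.norm_of_nonneg hr0.le] at key
    have : |g (z + r • v) - g z| * W ≤ ((η + ε) * r) * W := by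
      refine key.trans ?_
      have e3 : (2 * ↑L * (δ * r) + η * r) * W + ↑L * (r * ‖v‖) * (θ * ((M / δ) ^ k * W))
        = ((2 * L * δ + η) + L * ‖v‖ * (θ * (M / δ) ^ k)) * r * W := by ring
      rw [e3]
      have : 2 * L * δ + η + L * ‖v‖ * (θ * (M / δ) ^ k) ≤ η + ε := by linarith
      gcongr
    exact le_of_mul_le_mul_right this hW
  · intro p hp
    rw [lineDeriv_smul, smul_eq_mul, abs_mul, abs_of_pos hr0, mul_comm]
    gcongr
    exact hgE p hp
  · intro t ht
    refine le_trans (measureReal_mono (sdiff_subset_sdiff_left ?_) ?_) hr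
    · intro y hy
      rw [mem_ball, dist_eq_norm] at hy hz
      rw [mem_closedBall, dist_eq_norm]
      have e : y - x = (y - (z + t • r • v)) + (z - x) + t • r • v := by abel
      rw [e]
      refine (norm_add_le _ _).trans ((add_le_add_left (norm_add_le _ _) _).trans ?_)
      have : ‖t • r • v‖ ≤ r * ‖v‖ := by
        rw [norm_smul, norm_smul, Real.norm_of_nonneg ht.1, Real.norm_of_nonneg hr0.le]
        have : 0 ≤ r * ‖v‖ := by positivity
        nlinarith [ht.2]
      nlinarith
    · exact ((measure_mono sdiff_subset).trans_lt measure_closedBall_lt_top).ne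

lemma approx_unique {k : ℕ} [Nontrivial (EucSp k)] {A : Set (EucSp k)} {f g : EucSp k → ℝ}
    {x : EucSp k} (hx : x ∈ A) (hfg : EqOn f g A) (hg : DifferentiableAt ℝ g x)
    {D : EucSp k →ₗ[ℝ] ℝ} (hD : HasApproxDerivWithinAt A f D x) (v : EucSp k) :
    fderiv ℝ g x v = D v := by
  obtain ⟨S, hSA, hS, hd, ht⟩ := hD
  have hd' : Tendsto (fun r => volume (S ∩ closedBall x r) / volume (closedBall x r))
      (𝓝[>] 0) (𝓝 1) := by
    refine hd.congr' ?_
    filter_upwards [self_mem_nhdsWithin] with r hr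
    have hr : 0 < r := hr
    rw [Measure.addHaar_closedBall_eq_addHaar_ball]
    congr 1
    refine measure_congr ?_
    have : (closedBall x r : Set (EucSp k)) =ᵐ[volume] ball x r := by
      rw [← ball_union_sphere]
      refine union_ae_eq_left_of_ae_eq_empty ?_
      exact ae_eq_empty.2 (Measure.addHaar_sphere_of_ne_zero _ _ hr.ne')
    exact (ae_eq_refl S).inter this.symm
  set M : EucSp k →L[ℝ] ℝ := fderiv ℝ g x - LinearMap.toContinuousLinearMap D with hM
  have hMa : ∀ w, M w = fderiv ℝ g x w - D w := fun w => by simp [hM]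
  by_contra hne
  have hMv : 0 < |M v| := by
    rw [abs_pos, hMa]; exact sub_ne_zero.2 hne
  set c : ℝ := |M v| / (2 * (‖v‖ + 1)) with hc
  have hc0 : 0 < c := by positivity
  have hcv : c * ‖v‖ < |M v| := by
    rw [hc, div_mul_eq_mul_div, div_lt_iff₀ (by positivity)]
    nlinarith [norm_nonneg v]
  set t : Set (EucSp k) := {w | c * ‖w‖ < |M w|} ∩ ball v 1 with htdef
  have hto : IsOpen t := (isOpen_lt (by fun_prop) (by fun_prop)).inter isOpen_ball
  have htp : volume t ≠ 0 := (hto.measure_pos volume ⟨v, hcv, by simp⟩).ne'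
  have hev := Measure.eventually_nonempty_inter_smul_of_density_one volume S x hd' t
    hto.measurableSet htp
  have h1 : ∀ᶠ y in 𝓝[S] x, |f y - f x - D (y - x)| / ‖y - x‖ < c / 2 :=
    (tendsto_order.1 ht).2 _ (by positivity)
  have h2 : ∀ᶠ y in 𝓝 x, ‖g y - g x - fderiv ℝ g x (y - x)‖ ≤ c / 2 * ‖y - x‖ :=
    hg.hasFDerivAt.isLittleO.def (by positivity)
  have h3 := h2.filter_mono (nhdsWithin_le_nhds (s := S))
  obtain ⟨δ, hδ, hδ'⟩ := Metric.mem_nhdsWithin_iff.1 (h1.and h3)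
  have h4 : ∀ᶠ r in 𝓝[>] (0:ℝ), r * (‖v‖ + 1) < δ := by
    have : Tendsto (fun r : ℝ => r * (‖v‖ + 1)) (𝓝 0) (𝓝 (0 * (‖v‖ + 1))) :=
      (continuous_mul_const _).tendsto 0
    rw [zero_mul] at this
    exact ((tendsto_order.1 this).2 _ hδ).filter_mono nhdsWithin_le_nhds
  obtain ⟨r, ⟨y, hyS, hyt⟩, hrδ, hr0⟩ := (hev.and (h4.and self_mem_nhdsWithin)).exists
  have hr0 : 0 < r := hr0
  rw [singleton_add] at hyt
  obtain ⟨_, ⟨w, hw, rfl⟩, rfl⟩ := hyt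
  simp only at hyS
  have hwv : ‖w‖ ≤ ‖v‖ + 1 := by
    have := mem_ball_iff_norm.1 hw.2
    have h := norm_add_le (w - v) v
    rw [sub_add_cancel] at h
    linarith
  have hw0 : 0 < ‖w‖ := by
    rw [norm_pos_iff]
    rintro rfl
    have := hw.1
    simp at this
  have hyd : x + r • w ∈ ball x δ ∩ S := by
    refine ⟨?_, hyS⟩
    rw [mem_ball_iff_norm, add_sub_cancel_left, norm_smul, Real.norm_of_nonneg hr0.le]
    refine lt_of_le_of_lt ?_ hrδ
    gcongr
  obtain ⟨k1, k2⟩ := hδ' hyd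
  rw [hfg (hSA hyS), hfg hx] at k1
  have hnorm : ‖x + r • w - x‖ = r * ‖w‖ := by
    rw [add_sub_cancel_left, norm_smul, Real.norm_of_nonneg hr0.le]
  rw [hnorm] at k1 k2
  rw [div_lt_iff₀ (by positivity)] at k1
  rw [add_sub_cancel_left, map_smul, smul_eq_mul] at k1 k2
  rw [Real.norm_eq_abs] at k2
  have hwc : c * ‖w‖ < |M w| := hw.1
  have k3 : r * |M w| = |(g (x + r • w) - g x - r * D w) -
      (g (x + r • w) - g x - r * fderiv ℝ g x w)| := by
    rw [← abs_of_pos hr0, ← abs_mul, hMa, abs_of_pos hr0]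
    congr 1
    ring
  have k4 := abs_sub (g (x + r • w) - g x - r * D w) (g (x + r • w) - g x - r * fderiv ℝ g x w)
  have k5 : r * (c * ‖w‖) < r * |M w| := by gcongr
  linarith

def goodSet {k : ℕ} (F : EucSp k → LpInfty) (l m : ℕ) : Set (EucSp k) :=
  {p | ∀ i, |lineDeriv ℝ (fun y => F y i) p (TopologicalSpace.denseSeq (EucSp k) l)|
    ≤ 1 / ((m : ℝ) + 1)}

lemma comp_lip {k : ℕ} {F : EucSp k → LpInfty} {L : ℝ≥0} (hF : LipschitzWith L F) (i : ℕ) :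
    LipschitzWith L (fun y => F y i) := by
  refine LipschitzWith.of_dist_le_mul fun a b => le_trans ?_ (hF.dist_le_mul a b)
  rw [dist_eq_norm, dist_eq_norm]
  exact lp.norm_apply_le_norm (by simp) (F a - F b) i

lemma goodSet_meas {k : ℕ} {F : EucSp k → LpInfty} {L : ℝ≥0} (hF : LipschitzWith L F)
    (l m : ℕ) : MeasurableSet (goodSet F l m) := by
  have : goodSet F l m = ⋂ i, {p | |lineDeriv ℝ (fun y => F y i) p
      (TopologicalSpace.denseSeq (EucSp k) l)| ≤ 1 / ((m : ℝ) + 1)} := by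
    ext; simp [goodSet]
  rw [this]
  refine MeasurableSet.iInter fun i => ?_
  have hm : Measurable fun p => lineDeriv ℝ (fun y => F y i) p
      (TopologicalSpace.denseSeq (EucSp k) l) := measurable_lineDeriv (comp_lip hF i).continuous
  exact measurableSet_le (continuous_abs.measurable.comp hm) measurable_const

lemma claimC {k : ℕ} {F : EucSp k → LpInfty} {L : ℝ≥0} (hF : LipschitzWith L F) (x : EucSp k)
    (hdiff : ∀ i, DifferentiableAt ℝ (fun y => F y i) x)
    (hgood : ∀ l m, x ∈ goodSet F l m →
      Tendsto (fun r => volume (goodSet F l m ∩ closedBall x r) / volume (closedBall x r))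
      (𝓝[>] 0) (𝓝 1)) (R : ℝ) {ε : ℝ} (hε : 0 < ε) :
    ∀ᶠ r in 𝓝[>] (0:ℝ), ∀ z ∈ ball x r, ∀ a : EucSp k,
      (∀ i, fderiv ℝ (fun y => F y i) x a = 0) → ‖a‖ ≤ R * r → ‖F (z + a) - F z‖ ≤ ε * r := by
  obtain ⟨m, hm⟩ := exists_nat_one_div_lt (show 0 < ε / 3 by positivity)
  set η : ℝ := 1 / ((m : ℝ) + 1) with hη
  have hη0 : 0 < η := by positivity
  set σ : ℝ := η / (L + 1) with hσ
  have hσ0 : 0 < σ := by positivity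
  have hσL : L * σ ≤ η := by
    rw [hσ, mul_div_assoc', div_le_iff₀ (by positivity)]
    nlinarith
  obtain ⟨t, ht⟩ := (isCompact_closedBall (0 : EucSp k) R).elim_finite_subcover
    (fun l => ball (TopologicalSpace.denseSeq (EucSp k) l) σ) (fun _ => isOpen_ball) (by
      intro y _
      obtain ⟨_, ⟨l, rfl⟩, hl⟩ := (TopologicalSpace.denseRange_denseSeq (EucSp k)).exists_dist_lt
        y hσ0 |> fun ⟨l, hl⟩ => (⟨_, ⟨l, rfl⟩, hl⟩ : ∃ p ∈ range (TopologicalSpace.denseSeq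
          (EucSp k)), dist y p < σ)
      exact mem_iUnion.2 ⟨l, hl⟩)
  have hev : ∀ᶠ r in 𝓝[>] (0:ℝ), ∀ l ∈ t, x ∈ goodSet F l m → ∀ z ∈ ball x r,
      ∀ g : EucSp k → ℝ, LipschitzWith L g →
      (∀ p ∈ goodSet F l m, |lineDeriv ℝ g p (TopologicalSpace.denseSeq (EucSp k) l)| ≤ η) →
      |g (z + r • (TopologicalSpace.denseSeq (EucSp k) l)) - g z| ≤ (η + ε / 3) * r := by
    rw [Filter.eventually_all_finset]
    intro l _
    by_cases hl : x ∈ goodSet F l m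
    · filter_upwards [lemA L x (TopologicalSpace.denseSeq (EucSp k) l) _ (goodSet_meas hF l m)
        (hgood l m hl) hη0.le (show 0 < ε / 3 by positivity)] with r hr _
      exact hr
    · exact Eventually.of_forall fun r h => absurd h hl
  filter_upwards [hev, self_mem_nhdsWithin] with r hr hr0
  have hr0 : 0 < r := hr0
  intro z hz a ha haR
  set v : EucSp k := r⁻¹ • a with hv
  have hav : a = r • v := by rw [hv, smul_smul, mul_inv_cancel₀ hr0.ne', one_smul]
  have hvR : v ∈ closedBall (0 : EucSp k) R := by
    rw [mem_closedBall_zero_iff, hv, norm_smul, norm_inv, Real.norm_of_nonneg hr0.le,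
      inv_mul_le_iff₀ hr0]
    linarith
  obtain ⟨l, hl, hlv⟩ := mem_iUnion₂.1 (ht hvR)
  set q := TopologicalSpace.denseSeq (EucSp k) l with hq
  rw [mem_ball_iff_norm] at hlv
  have hxg : x ∈ goodSet F l m := by
    intro i
    rw [(hdiff i).lineDeriv_eq_fderiv]
    have h0 : fderiv ℝ (fun y => F y i) x v = 0 := by
      rw [hv, map_smul, ha i, smul_zero]
    have h1 : fderiv ℝ (fun y => F y i) x q = fderiv ℝ (fun y => F y i) x (q - v) := by
      rw [map_sub, h0, sub_zero]
    rw [← hq, h1, ← Real.norm_eq_abs]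
    refine (ContinuousLinearMap.le_opNorm _ _).trans (le_trans ?_ hσL)
    have := norm_fderiv_le_of_lipschitz ℝ (comp_lip hF i) (x₀ := x)
    rw [norm_sub_rev]
    gcongr
  refine lp.norm_le_of_forall_le (by positivity) fun i => ?_
  have h1 := hr l hl hxg z hz (fun y => F y i) (comp_lip hF i) (fun p hp => hp i)
  have h2 := (comp_lip hF i).dist_le_mul (z + a) (z + r • q)
  rw [dist_add_left, hav, dist_eq_norm (r • v), ← smul_sub, norm_smul, Real.norm_of_nonneg hr0.le,
    Real.dist_eq] at h2
  have h3 : L * (r * ‖v - q‖) ≤ η * r := by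
    have : L * (r * ‖v - q‖) ≤ L * (r * σ) := by gcongr
    nlinarith
  change |F (z + a) i - F z i| ≤ _
  rw [hav]
  have h4 := abs_sub_le (F (z + r • v) i) (F (z + r • q) i) (F z i)
  have h5 : (η + (η + ε / 3)) * r ≤ ε * r := by gcongr; linarith
  nlinarith

lemma hContent_le {X : Type*} [PseudoEMetricSpace X] {n : ℕ} (hn : n ≠ 0) {ι : Type*} [Fintype ι]
    {E : Set X} (G : ι → Set X) (hE : E ⊆ ⋃ i, G i) {d : ℝ≥0∞}
    (hd : ∀ i, EMetric.diam (G i) ≤ d) :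
    hContent n E ≤ unitBallVol n / 2 ^ n * (Fintype.card ι * d ^ n) := by
  classical
  set N := Fintype.card ι with hN
  let e : ι ≃ Fin N := Fintype.equivFin ι
  let A : ℕ → Set X := fun i => if h : i < N then G (e.symm ⟨i, h⟩) else ∅
  have hA : E ⊆ ⋃ i, A i := by
    intro y hy
    obtain ⟨i, hi⟩ := mem_iUnion.1 (hE hy)
    refine mem_iUnion.2 ⟨e i, ?_⟩
    simp only [A, (e i).2, dif_pos]
    simpa using hi
  refine (iInf₂_le A hA).trans ?_
  gcongr
  rw [tsum_eq_sum (s := Finset.range N)]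
  · refine (Finset.sum_le_card_nsmul _ _ (d ^ n) ?_).trans ?_
    · intro i hi
      have hi : i < N := Finset.mem_range.1 hi
      simp only [A, hi, dif_pos]
      gcongr
      exact hd _
    · simp
  · intro i hi
    have hi : ¬ i < N := fun h => hi (Finset.mem_range.2 h)
    have h0 : EMetric.diam (A i) = 0 := by
      simp only [A, hi, dif_neg, not_false_eq_true]
      exact Metric.ediam_empty
    rw [h0, zero_pow hn]

lemma exists_split {k j : ℕ} (D : EucSp k →ₗ[ℝ] (ℕ → ℝ)) (hD : LinearMap.rank D = (j : Cardinal)) :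
    ∃ (T : EucSp k →L[ℝ] (Fin j → ℝ)) (S : (Fin j → ℝ) →L[ℝ] EucSp k),
      (∀ a, T a = 0 → D a = 0) ∧ ∀ b, T (S b) = b := by
  have hfr : Module.finrank ℝ (LinearMap.range D) = j := Module.finrank_eq_of_rank_eq hD
  let e : LinearMap.range D ≃ₗ[ℝ] (Fin j → ℝ) :=
    LinearEquiv.ofFinrankEq _ _ (by simpa using hfr)
  let T : EucSp k →ₗ[ℝ] (Fin j → ℝ) := e.toLinearMap.comp D.rangeRestrict
  have hsurj : LinearMap.range T = ⊤ := by
    rw [LinearMap.range_eq_top]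
    exact e.surjective.comp D.surjective_rangeRestrict
  obtain ⟨S, hS⟩ := T.exists_rightInverse_of_surjective hsurj
  refine ⟨LinearMap.toContinuousLinearMap T, LinearMap.toContinuousLinearMap S, ?_, ?_⟩
  · intro a ha
    have ha : e (D.rangeRestrict a) = 0 := ha
    have := e.map_eq_zero_iff.1 ha
    exact congrArg Subtype.val this
  · intro b
    exact LinearMap.congr_fun hS b

lemma cover {k j n : ℕ} (hn : n ≠ 0) {F : EucSp k → LpInfty} {L : ℝ≥0} (hF : LipschitzWith L F)
    (x : EucSp k) (T : EucSp k →L[ℝ] (Fin j → ℝ)) (S : (Fin j → ℝ) →L[ℝ] EucSp k)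
    (hTS : ∀ b, T (S b) = b) {C : ℕ} (hC : ‖T‖ ≤ C) {q : ℕ} (hq : 1 ≤ q) {r : ℝ} (hr : 0 < r)
    (hcl : ∀ z ∈ ball x r, ∀ a : EucSp k, T a = 0 → ‖a‖ ≤ (2 + ‖S‖) * r →
      ‖F (z + a) - F z‖ ≤ 1 / q * r) :
    hContent n (F '' ball x r) ≤ unitBallVol n / 2 ^ n *
      (((2 * (C * q) + 1) ^ j : ℕ) * ENNReal.ofReal ((L * ‖S‖ + 1) * r / q) ^ n) := by
  have hq0 : (0:ℝ) < q := by exact_mod_cast hq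
  have hq1 : (1:ℝ) ≤ q := by exact_mod_cast hq
  let I : Finset ℤ := Finset.Icc (-(C * q : ℕ) : ℤ) (C * q : ℕ)
  have hcard : Fintype.card (Fin j → I) = (2 * (C * q) + 1) ^ j := by
    rw [Fintype.card_fun, Fintype.card_fin, Fintype.card_coe]
    congr 1
    simp only [I, Int.card_Icc]
    omega
  rw [← hcard]
  refine hContent_le hn (ι := Fin j → I)
    (fun m => F '' {p ∈ ball x r | ∀ i, ⌊T (p - x) i * (q / r)⌋ = m i}) ?_ ?_
  · rintro _ ⟨p, hp, rfl⟩
    have hb : ∀ i, ⌊T (p - x) i * (q / r)⌋ ∈ I := by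
      intro i
      have h1 : |T (p - x) i| ≤ C * r := by
        rw [← Real.norm_eq_abs]
        refine (norm_le_pi_norm _ i).trans ((T.le_opNorm _).trans ?_)
        have := (mem_ball_iff_norm.1 hp).le
        gcongr
      have h2 : |T (p - x) i * (q / r)| ≤ C * q := by
        rw [abs_mul, abs_of_pos (by positivity : 0 < (q / r : ℝ))]
        calc _ ≤ (C * r) * (q / r : ℝ) := by gcongr
          _ = _ := by field_simp
      rw [abs_le] at h2
      refine Finset.mem_Icc.2 ⟨Int.le_floor.2 ?_, ?_⟩
      · push_cast; linarith
      · have h3 : ((⌊T (p - x) i * (q / r)⌋ : ℤ) : ℝ) ≤ ((C * q : ℕ) : ℤ) := by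
          refine (Int.floor_le _).trans ?_
          push_cast; linarith
        exact_mod_cast h3
    exact mem_iUnion.2 ⟨fun i => ⟨_, hb i⟩, p, ⟨hp, fun i => rfl⟩, rfl⟩
  · intro m
    refine EMetric.diam_le ?_
    rintro _ ⟨y, ⟨hy, hym⟩, rfl⟩ _ ⟨z, ⟨hz, hzm⟩, rfl⟩
    rw [edist_dist]
    refine ENNReal.ofReal_le_ofReal ?_
    have hT : ‖T (y - z)‖ ≤ r / q := by
      refine (pi_norm_le_iff_of_nonneg (by positivity)).2 fun i => ?_
      have h1 := Int.abs_sub_lt_one_of_floor_eq_floor ((hym i).trans (hzm i).symm)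
      rw [← sub_mul, abs_mul, abs_of_pos (by positivity : 0 < (q / r : ℝ))] at h1
      have h2 : T (y - x) i - T (z - x) i = T (y - z) i := by
        rw [← Pi.sub_apply, ← map_sub, sub_sub_sub_cancel_right]
      rw [h2] at h1
      rw [Real.norm_eq_abs, le_div_iff₀ hq0]
      rw [mul_div_assoc', div_lt_one hr] at h1
      exact h1.le
    set b := S (T (y - z)) with hb
    have hbn : ‖b‖ ≤ ‖S‖ * (r / q) := (S.le_opNorm _).trans (by gcongr)
    have hrq : r / q ≤ r := div_le_self hr.le hq1
    set a := y - z - b with ha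
    have hTa : T a = 0 := by rw [ha, map_sub, hb, hTS, sub_self]
    have hyz : ‖y - z‖ ≤ 2 * r := by
      have e : y - z = (y - x) - (z - x) := by abel
      rw [e]
      have := norm_sub_le (y - x) (z - x)
      have h1 := mem_ball_iff_norm.1 hy
      have h2 := mem_ball_iff_norm.1 hz
      linarith
    have han : ‖a‖ ≤ (2 + ‖S‖) * r := by
      have := norm_sub_le (y - z) b
      have h2 : ‖S‖ * (r / q) ≤ ‖S‖ * r := by gcongr
      rw [ha]
      linarith
    have h1 := hcl z hz a hTa han
    have h2 := hF.dist_le_mul y (z + a)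
    have h3 : dist y (z + a) = ‖b‖ := by
      rw [dist_eq_norm, ha]; congr 1; abel
    rw [h3] at h2
    rw [← dist_eq_norm] at h1
    calc dist (F y) (F z) ≤ _ := dist_triangle _ (F (z + a)) _
      _ ≤ L * (‖S‖ * (r / q)) + 1 / q * r := by
        refine add_le_add (h2.trans ?_) h1
        gcongr
      _ = _ := by field_simp

lemma numeric {j n C q : ℕ} (hj : j < n) (hq : 1 ≤ q) {c r : ℝ} (hc : 0 ≤ c) (hr : 0 < r) :
    (((2 * (C * q) + 1) ^ j : ℕ) : ℝ≥0∞) * ENNReal.ofReal (c * r / q) ^ n ≤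
      ENNReal.ofReal (((2 * C + 1) ^ j * c ^ n) / q) * ENNReal.ofReal r ^ n := by
  have hq0 : (0:ℝ) < q := by exact_mod_cast hq
  have hq1 : (1:ℝ) ≤ q := by exact_mod_cast hq
  rw [← ENNReal.ofReal_natCast, ← ENNReal.ofReal_pow (by positivity),
    ← ENNReal.ofReal_pow (by positivity), ← ENNReal.ofReal_mul (by positivity),
    ← ENNReal.ofReal_mul (by positivity)]
  refine ENNReal.ofReal_le_ofReal ?_
  push_cast
  have h1 : ((2 * ((C:ℝ) * q) + 1) ^ j) ≤ (2 * C + 1) ^ j * q ^ j := by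
    rw [← mul_pow]
    gcongr
    nlinarith
  have h2 : (q:ℝ) ^ (j + 1) ≤ q ^ n := pow_le_pow_right₀ hq1 hj
  calc ((2 * ((C:ℝ) * q) + 1) ^ j) * (c * r / q) ^ n
      ≤ ((2 * C + 1) ^ j * q ^ j) * (c * r / q) ^ n := by gcongr
    _ = ((2 * C + 1) ^ j * c ^ n) * r ^ n * (q ^ j / q ^ n) := by
      rw [div_pow, mul_pow]; ring
    _ ≤ ((2 * C + 1) ^ j * c ^ n) * r ^ n * (1 / q) := by
      refine mul_le_mul_of_nonneg_left ?_ (by positivity)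
      rw [div_le_div_iff₀ (by positivity) hq0, one_mul, ← pow_succ]
      exact h2
    _ = _ := by ring

lemma density_zero {k j n : ℕ} (hj : j < n) {A : Set (EucSp k)} {f F : EucSp k → LpInfty}
    {L : ℝ≥0} (hF : LipschitzWith L F) (hfF : EqOn f F A) (x : EucSp k)
    (T : EucSp k →L[ℝ] (Fin j → ℝ)) (S : (Fin j → ℝ) →L[ℝ] EucSp k)
    (hTS : ∀ b, T (S b) = b)
    (hcl : ∀ R ε : ℝ, 0 < ε → ∀ᶠ r in 𝓝[>] (0:ℝ), ∀ z ∈ ball x r, ∀ a : EucSp k, T a = 0 →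
      ‖a‖ ≤ R * r → ‖F (z + a) - F z‖ ≤ ε * r) :
    upperDensity n f A x ≤ 0 := by
  obtain ⟨C, hC⟩ := exists_nat_ge ‖T‖
  set K : ℝ := (2 * C + 1) ^ j * (L * ‖S‖ + 1) ^ n with hK
  have hlim : Tendsto (fun q : ℕ => ENNReal.ofReal (K / ((q + 1 : ℕ) : ℝ))) atTop (𝓝 0) := by
    have h := (tendsto_const_div_atTop_nhds_zero_nat K).comp (tendsto_add_atTop_nat 1)
    have h' := ENNReal.tendsto_ofReal h
    rw [ENNReal.ofReal_zero] at h'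
    exact h'
  refine ge_of_tendsto' hlim fun q => ?_
  have hq : 1 ≤ q + 1 := by omega
  refine limsup_le_of_le ?_ ?_
  · isBoundedDefault
  filter_upwards [hcl (2 + ‖S‖) (1 / ((q + 1 : ℕ) : ℝ)) (by positivity), self_mem_nhdsWithin]
    with r hr hr0
  have hr0 : 0 < r := hr0
  have hsub : f '' (ball x r ∩ A) ⊆ F '' ball x r := by
    rintro _ ⟨p, ⟨hp, hpA⟩, rfl⟩
    exact ⟨p, hp, (hfF hpA).symm⟩
  have hmono : hContent n (f '' (ball x r ∩ A)) ≤ hContent n (F '' ball x r) :=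
    le_iInf₂ fun G hG => iInf₂_le G (hsub.trans hG)
  refine ENNReal.div_le_of_le_mul (hmono.trans
    ((cover (by omega) hF x T S hTS hC hq hr0 hr).trans ?_))
  calc _ ≤ unitBallVol n * (ENNReal.ofReal (K / ((q + 1 : ℕ) : ℝ)) * ENNReal.ofReal r ^ n) := by
        refine mul_le_mul' ?_ (numeric hj hq (by positivity) hr0)
        exact ENNReal.div_le_of_le_mul (le_mul_of_one_le_right' (one_le_pow₀ (by norm_num)))
    _ = _ := by ring

/-- Remark bluerem: for `j < n ≤ k` and a Lipschitz `f : A → ℓ^∞`,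
the set of points `x ∈ A` where `Θ^{*n}(f,x) > 0`, the component-wise approximate
derivative exists, and its rank equals `j`, has Lebesgue measure zero. -/
theorem stmt8 {k n j : ℕ} (hnk : n ≤ k) (hj : j < n)
    (A : Set (EucSp k)) (hA : MeasurableSet A)
    (f : EucSp k → LpInfty) (hf : ∃ L : ℝ≥0, LipschitzOnWith L f A) :
    volume {x ∈ A | 0 < upperDensity n f A x ∧ ∃ D : EucSp k →ₗ[ℝ] (ℕ → ℝ),
      HasCompApproxDerivWithinAt A f D x ∧ LinearMap.rank D = (j : Cardinal)} = 0 := by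
  obtain ⟨L, hL⟩ := hf
  obtain ⟨F, hF, hfF⟩ := hL.extend_lp_infty
  have hk : 0 < k := by omega
  have : Nonempty (Fin k) := ⟨⟨0, hk⟩⟩
  have : Nontrivial (EucSp k) := inferInstance
  have h1 : ∀ᵐ x ∂(volume : Measure (EucSp k)), ∀ i, DifferentiableAt ℝ (fun y => F y i) x :=
    ae_all_iff.2 fun i => (comp_lip hF i).ae_differentiableAt
  have h2 : ∀ᵐ x ∂(volume : Measure (EucSp k)), ∀ l m, x ∈ goodSet F l m →
      Tendsto (fun r => volume (goodSet F l m ∩ closedBall x r) / volume (closedBall x r))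
      (𝓝[>] 0) (𝓝 1) :=
    ae_all_iff.2 fun l => ae_all_iff.2 fun m =>
      (ae_restrict_iff' (goodSet_meas hF l m)).1
        (Besicovitch.ae_tendsto_measure_inter_div volume (goodSet F l m))
  have h3 : ∀ᵐ x ∂(volume : Measure (EucSp k)), ¬ (x ∈ A ∧ 0 < upperDensity n f A x ∧
      ∃ D : EucSp k →ₗ[ℝ] (ℕ → ℝ),
        HasCompApproxDerivWithinAt A f D x ∧ LinearMap.rank D = (j : Cardinal)) := by
    filter_upwards [h1, h2] with x hx1 hx2
    rintro ⟨hxA, hpos, D, hD, hrank⟩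
    obtain ⟨T, S, hTD, hTS⟩ := exists_split D hrank
    refine hpos.not_ge (density_zero hj hF hfF x T S hTS fun R ε hε => ?_)
    filter_upwards [claimC hF x hx1 hx2 R hε] with r hr z hz a ha haR
    refine hr z hz a (fun i => ?_) haR
    rw [approx_unique hxA (fun y hy => by simp only [hfF hy]) (hx1 i) (hD i)]
    have := hTD a ha
    simp [this]
  have h4 := ae_iff.1 h3
  simpa only [not_not] using h4

end
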